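/- Let μ ∈ 𝕎₂(ℝ^m), and let T_θ, T_{θ'} : ℝ^m → ℝ^m be Lipschitz maps (with some common Lipschitz constant L). Then W₂((T_θ)♯μ, (T_{θ'})♯μ) = lim_{σ→0} W₂((T_θ)♯(μ∗g_σ), (T_{θ'})♯(μ∗g_σ)). -/

import Mathlib

open MeasureTheory Filter Set
open scoped ENNReal NNReal

noncomputable section

/-- The 2-Wasserstein distance between two measures on `ℝ^m`, defined as the infimum
over all couplings (probability measures on the product whose marginals are `μ` and `ν`)
of the square root of the quadratic transport cost. -/
noncomputable def W2 {m : ℕ} (μ ν : Measure (EuclideanSpace ℝ (Fin m))) : ℝ≥0∞ :=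
  ⨅ (γ : Measure (EuclideanSpace ℝ (Fin m) × EuclideanSpace ℝ (Fin m)))
    (_ : IsProbabilityMeasure γ) (_ : γ.map Prod.fst = μ) (_ : γ.map Prod.snd = ν),
    (∫⁻ p, ENNReal.ofReal (‖p.1 - p.2‖ ^ 2) ∂γ) ^ (1 / 2 : ℝ)

/-- A measure has finite second moment if `∫ |x|² dμ < ∞`. -/
def FiniteSecondMoment {m : ℕ} (μ : Measure (EuclideanSpace ℝ (Fin m))) : Prop :=
  ∫⁻ x, ENNReal.ofReal (‖x‖ ^ 2) ∂μ ≠ ⊤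

/-- The multivariate Gaussian density `g_σ(x) = (2πσ²)^{−m/2} exp(−|x|²/(2σ²))` on `ℝ^m`. -/
noncomputable def gauss (m : ℕ) (σ : ℝ) (x : EuclideanSpace ℝ (Fin m)) : ℝ :=
  (2 * Real.pi * σ ^ 2) ^ (-(m : ℝ) / 2) * Real.exp (-‖x‖ ^ 2 / (2 * σ ^ 2))

/-- The convolution `μ∗g_σ` of a measure `μ` with the Gaussian of density `g_σ`: the
absolutely continuous measure with density `x ↦ ∫ g_σ(x−y) dμ(y)`. -/
noncomputable def mollify {m : ℕ} (σ : ℝ) (μ : Measure (EuclideanSpace ℝ (Fin m))) :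
    Measure (EuclideanSpace ℝ (Fin m)) :=
  volume.withDensity fun x => ENNReal.ofReal (∫ y, gauss m σ (x - y) ∂μ)

open ProbabilityTheory

lemma W2_le_of_coupling {m : ℕ} {Ω : Type*} [MeasurableSpace Ω] (P : Measure Ω)
    [IsProbabilityMeasure P] (X Y : Ω → EuclideanSpace ℝ (Fin m)) (hX : Measurable X)
    (hY : Measurable Y) :
    W2 (P.map X) (P.map Y) ≤ (∫⁻ ω, ‖X ω - Y ω‖ₑ ^ (2:ℝ) ∂P) ^ (1 / 2 : ℝ) := by
  have hXY : Measurable (fun ω => (X ω, Y ω)) := hX.prodMk hY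
  unfold W2
  refine iInf_le_of_le (P.map (fun ω => (X ω, Y ω))) ?_
  refine iInf_le_of_le (Measure.isProbabilityMeasure_map hXY.aemeasurable) ?_
  refine iInf_le_of_le (by rw [Measure.map_map measurable_fst hXY]; rfl) ?_
  refine iInf_le_of_le (by rw [Measure.map_map measurable_snd hXY]; rfl) ?_
  rw [lintegral_map (by fun_prop) hXY]
  apply le_of_eq
  congr 1
  refine lintegral_congr fun ω => ?_
  rw [ENNReal.ofReal_pow (norm_nonneg _), ofReal_norm]
  norm_cast

lemma W2_comm_le {m : ℕ} (μ ν : Measure (EuclideanSpace ℝ (Fin m))) : W2 μ ν ≤ W2 ν μ := by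
  conv_rhs => unfold W2
  refine le_iInf fun γ => le_iInf fun hγ => le_iInf fun h1 => le_iInf fun h2 => ?_
  subst h1 h2
  refine (W2_le_of_coupling γ Prod.snd Prod.fst measurable_snd measurable_fst).trans ?_
  apply le_of_eq
  congr 1
  refine lintegral_congr fun ω => ?_
  rw [ENNReal.ofReal_pow (norm_nonneg _), ofReal_norm, ← enorm_neg, neg_sub]
  norm_cast

lemma W2_triangle {m : ℕ} (μ ν ρ : Measure (EuclideanSpace ℝ (Fin m))) :
    W2 μ ρ ≤ W2 μ ν + W2 ν ρ := by
  refine (?_ : _ ≤ W2 ν μ + W2 ν ρ).trans (by gcongr; exact W2_comm_le _ _)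
  have key : ∀ γ₁ γ₂ : Measure (EuclideanSpace ℝ (Fin m) × EuclideanSpace ℝ (Fin m)),
      IsProbabilityMeasure γ₁ → IsProbabilityMeasure γ₂ → γ₁.map Prod.fst = ν →
      γ₂.map Prod.fst = ν → γ₁.map Prod.snd = μ → γ₂.map Prod.snd = ρ →
      W2 μ ρ ≤ (∫⁻ p, ENNReal.ofReal (‖p.1 - p.2‖ ^ 2) ∂γ₁) ^ (1 / 2 : ℝ) +
        (∫⁻ p, ENNReal.ofReal (‖p.1 - p.2‖ ^ 2) ∂γ₂) ^ (1 / 2 : ℝ) := by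
    intro γ₁ γ₂ i1 i2 h1 h2 h3 h4
    have : IsProbabilityMeasure ν := h1 ▸ Measure.isProbabilityMeasure_map (by fun_prop)
    let P := ν ⊗ₘ (γ₁.condKernel ×ₖ γ₂.condKernel)
    have m1 : P.map (fun p => (p.1, p.2.1)) = γ₁ := by
      conv_rhs => rw [← γ₁.disintegrate γ₁.condKernel]
      ext s hs
      rw [Measure.map_apply (by fun_prop) hs, Measure.compProd_apply hs,
        Measure.compProd_apply (by measurability)]
      simp only [Measure.fst, h1]
      refine lintegral_congr fun a => ?_
      conv_rhs => rw [← Kernel.fst_prod γ₁.condKernel γ₂.condKernel]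
      rw [Kernel.fst_apply' _ _ (by measurability)]
      rfl
    have m2 : P.map (fun p => (p.1, p.2.2)) = γ₂ := by
      conv_rhs => rw [← γ₂.disintegrate γ₂.condKernel]
      ext s hs
      rw [Measure.map_apply (by fun_prop) hs, Measure.compProd_apply hs,
        Measure.compProd_apply (by measurability)]
      simp only [Measure.fst, h2]
      refine lintegral_congr fun a => ?_
      conv_rhs => rw [← Kernel.snd_prod γ₁.condKernel γ₂.condKernel]
      rw [Kernel.snd_apply' _ _ (by measurability)]
      rfl
    have e1 : P.map (fun p => p.2.1) = μ := by
      rw [← h3, ← m1, Measure.map_map (by fun_prop) (by fun_prop)]; rfl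
    have e2 : P.map (fun p => p.2.2) = ρ := by
      rw [← h4, ← m2, Measure.map_map (by fun_prop) (by fun_prop)]; rfl
    rw [← e1, ← e2]
    refine (W2_le_of_coupling P _ _ (by fun_prop) (by fun_prop)).trans ?_
    rw [← m1, ← m2, lintegral_map (by fun_prop) (by fun_prop),
      lintegral_map (by fun_prop) (by fun_prop)]
    refine le_trans ?_ ((ENNReal.lintegral_Lp_add_le (μ := P) (p := 2)
      (f := fun p => ‖p.1 - p.2.1‖ₑ) (g := fun p => ‖p.1 - p.2.2‖ₑ)
      (by fun_prop) (by fun_prop) (by norm_num)).trans (le_of_eq ?_))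
    · gcongr with p
      simp only [Pi.add_apply]
      calc ‖p.2.1 - p.2.2‖ₑ = ‖-(p.1 - p.2.1) + (p.1 - p.2.2)‖ₑ := by congr 1; abel
        _ ≤ _ := (enorm_add_le _ _).trans (by rw [enorm_neg])
    · congr 2 <;>
      · refine lintegral_congr fun ω => ?_
        rw [ENNReal.ofReal_pow (norm_nonneg _), ofReal_norm]
        norm_cast
  conv_rhs => unfold W2
  simp only [ENNReal.iInf_add, ENNReal.add_iInf]
  refine le_iInf fun γ₁ => le_iInf fun i1 => le_iInf fun h1 => le_iInf fun h2 => 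
    le_iInf fun γ₂ => le_iInf fun i2 => le_iInf fun h3 => le_iInf fun h4 => ?_
  apply key <;> assumption

def gM (m : ℕ) (σ : ℝ) : Measure (EuclideanSpace ℝ (Fin m)) :=
  volume.withDensity fun x => ENNReal.ofReal (gauss m σ x)

lemma gauss_nonneg (m : ℕ) (σ : ℝ) (x) : 0 ≤ gauss m σ x := by
  unfold gauss; positivity

lemma gauss_cont (m : ℕ) (σ : ℝ) : Continuous (gauss m σ) := by
  unfold gauss; fun_prop

lemma gauss_le (m : ℕ) (σ : ℝ) (x) : gauss m σ x ≤ (2 * Real.pi * σ ^ 2) ^ (-(m : ℝ) / 2) := by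
  unfold gauss
  apply mul_le_of_le_one_right (by positivity)
  rw [Real.exp_le_one_iff, neg_div]
  have : 0 ≤ ‖x‖ ^ 2 / (2 * σ ^ 2) := by positivity
  linarith

lemma gM_prob (m : ℕ) {σ : ℝ} (hσ : 0 < σ) : IsProbabilityMeasure (gM m σ) := by
  have hb : (0:ℝ) < 1 / (2 * σ ^ 2) := by positivity
  have hI : ∫ x : EuclideanSpace ℝ (Fin m), gauss m σ x = 1 := by
    unfold gauss
    rw [integral_const_mul]
    have := GaussianFourier.integral_rexp_neg_mul_sq_norm (V := EuclideanSpace ℝ (Fin m)) hb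
    simp only [finrank_euclideanSpace, Fintype.card_fin] at this
    have h2 : ∀ v : EuclideanSpace ℝ (Fin m), -‖v‖ ^ 2 / (2 * σ ^ 2) = -(1 / (2 * σ ^ 2)) * ‖v‖ ^ 2 := by
      intro v; ring
    simp only [h2]
    rw [this, show Real.pi / (1 / (2 * σ ^ 2)) = 2 * Real.pi * σ ^ 2 by field_simp, neg_div,
      ← Real.rpow_add (by positivity)]
    simp
  constructor
  unfold gM
  rw [withDensity_apply _ MeasurableSet.univ, Measure.restrict_univ,
    ← ofReal_integral_eq_lintegral_ofReal, hI, ENNReal.ofReal_one]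
  · by_contra h
    rw [integral_undef h] at hI; norm_num at hI
  · exact ae_of_all _ (gauss_nonneg m σ)

lemma gM_moment (m : ℕ) {σ : ℝ} (hσ : 0 < σ) :
    ∫⁻ z, ‖z‖ₑ ^ (2:ℝ) ∂(gM m σ) ≤ ENNReal.ofReal (4 * σ ^ 2 * 2 ^ ((m:ℝ) / 2)) := by
  have hp := gM_prob m (σ := Real.sqrt 2 * σ) (by positivity)
  calc ∫⁻ z, ‖z‖ₑ ^ (2:ℝ) ∂(gM m σ)
      = ∫⁻ z, ENNReal.ofReal (gauss m σ z * ‖z‖ ^ 2) := by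
        unfold gM
        have := (gauss_cont m σ).measurable
        rw [lintegral_withDensity_eq_lintegral_mul _ (by fun_prop) (by fun_prop)]
        refine lintegral_congr fun z => ?_
        rw [ENNReal.ofReal_mul (gauss_nonneg _ _ _), ENNReal.ofReal_pow (norm_nonneg _), ofReal_norm]
        simp
    _ ≤ ∫⁻ z, ENNReal.ofReal (4 * σ ^ 2 * 2 ^ ((m:ℝ) / 2)) * ENNReal.ofReal (gauss m (Real.sqrt 2 * σ) z) := by
        refine lintegral_mono fun z => ?_
        rw [← ENNReal.ofReal_mul (by positivity)]
        apply ENNReal.ofReal_le_ofReal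
        unfold gauss
        have e1 : (2 * Real.pi * (Real.sqrt 2 * σ) ^ 2) ^ (-(m : ℝ) / 2)
            = 2 ^ (-((m : ℝ) / 2)) * (2 * Real.pi * σ ^ 2) ^ (-(m : ℝ) / 2) := by
          rw [mul_pow, Real.sq_sqrt (by norm_num), neg_div, 
            ← Real.mul_rpow (by positivity) (by positivity)]
          congr 1; ring
        have e2 : (2:ℝ) ^ ((m : ℝ) / 2) * 2 ^ (-((m : ℝ) / 2)) = 1 := by
          rw [← Real.rpow_add (by norm_num)]; simp
        set t := ‖z‖ ^ 2 / (4 * σ ^ 2) with ht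
        have e3 : ‖z‖ ^ 2 = 4 * σ ^ 2 * t := by rw [ht]; field_simp
        have e4 : -‖z‖ ^ 2 / (2 * σ ^ 2) = -t + -t := by rw [ht]; field_simp; ring
        have e5 : -‖z‖ ^ 2 / (2 * (Real.sqrt 2 * σ) ^ 2) = -t := by
          rw [mul_pow, Real.sq_sqrt (by norm_num), ht]; field_simp; ring
        rw [e4, e5, e1, e3, Real.exp_add]
        have e6 : t * Real.exp (-t) ≤ 1 := by
          rw [Real.exp_neg, ← div_eq_mul_inv, div_le_one (Real.exp_pos _)]
          linarith [Real.add_one_le_exp t]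
        generalize hA : (2 * Real.pi * σ ^ 2) ^ (-(m : ℝ) / 2) = A
        have hA0 : 0 ≤ A := by rw [← hA]; positivity
        calc _ = (A * (4 * σ ^ 2) * Real.exp (-t)) * (t * Real.exp (-t)) := by ring
          _ ≤ (A * (4 * σ ^ 2) * Real.exp (-t)) * 1 := by gcongr
          _ = (A * (4 * σ ^ 2) * Real.exp (-t)) * ((2:ℝ) ^ ((m : ℝ) / 2) * 2 ^ (-((m : ℝ) / 2))) := by rw [e2]
          _ = _ := by ring
    _ = ENNReal.ofReal (4 * σ ^ 2 * 2 ^ ((m:ℝ) / 2)) := by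
        rw [lintegral_const_mul' _ _ ENNReal.ofReal_ne_top]
        have := hp.measure_univ
        unfold gM at this
        rw [withDensity_apply _ MeasurableSet.univ, Measure.restrict_univ] at this
        rw [this, mul_one]

lemma mollify_eq {m : ℕ} (μ : Measure (EuclideanSpace ℝ (Fin m))) [IsProbabilityMeasure μ]
    {σ : ℝ} (hσ : 0 < σ) :
    mollify σ μ = (μ.prod (gM m σ)).map (fun p => p.1 + p.2) := by
  have := gM_prob m hσ
  have hg := (gauss_cont m σ).measurable
  have h1 : ∀ x : EuclideanSpace ℝ (Fin m), ENNReal.ofReal (∫ y, gauss m σ (x - y) ∂μ) =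
      ∫⁻ y, ENNReal.ofReal (gauss m σ (x - y)) ∂μ := by
    intro x
    rw [ofReal_integral_eq_lintegral_ofReal]
    · refine Integrable.of_bound
        (hg.comp (measurable_const.sub measurable_id)).aestronglyMeasurable ((2 * Real.pi * σ ^ 2) ^ (-(m : ℝ) / 2))
        (ae_of_all _ fun y => ?_)
      rw [Real.norm_of_nonneg (gauss_nonneg _ _ _)]
      exact gauss_le _ _ _
    · exact ae_of_all _ fun y => gauss_nonneg _ _ _
  ext s hs
  unfold mollify
  simp only [h1]
  rw [withDensity_apply _ hs, Measure.map_apply (by fun_prop) hs,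
    Measure.prod_apply (measurableSet_preimage (by fun_prop) hs),
    lintegral_lintegral_swap (by fun_prop)]
  refine lintegral_congr fun y => ?_
  have hs' : MeasurableSet (Prod.mk y ⁻¹' ((fun p : EuclideanSpace ℝ (Fin m) × EuclideanSpace ℝ (Fin m) => p.1 + p.2) ⁻¹' s)) :=
    measurableSet_preimage (by fun_prop) (measurableSet_preimage (by fun_prop) hs)
  unfold gM
  rw [withDensity_apply _ hs', ← lintegral_indicator hs, ← lintegral_indicator hs',
    ← lintegral_add_left_eq_self _ y]
  refine lintegral_congr fun z => ?_
  simp [indicator]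
  rfl

lemma W2_mollify_le {m : ℕ} (μ : Measure (EuclideanSpace ℝ (Fin m))) [IsProbabilityMeasure μ]
    (L : ℝ≥0) (T : EuclideanSpace ℝ (Fin m) → EuclideanSpace ℝ (Fin m))
    (hT : LipschitzWith L T) {σ : ℝ} (hσ : 0 < σ) :
    W2 ((mollify σ μ).map T) (μ.map T) ≤
      ((L:ℝ≥0∞) ^ (2:ℝ) * ENNReal.ofReal (4 * σ ^ 2 * 2 ^ ((m:ℝ) / 2))) ^ (1 / 2 : ℝ) := by
  have := gM_prob m hσ
  have hTm := hT.continuous.measurable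
  have e : μ.map T = (μ.prod (gM m σ)).map (fun p => T p.1) := by
    have : μ = (μ.prod (gM m σ)).map Prod.fst := by
      rw [Measure.map_fst_prod]; simp
    conv_lhs => rw [this]
    rw [Measure.map_map hTm (by fun_prop)]; rfl
  rw [e, mollify_eq μ hσ, Measure.map_map hTm (by fun_prop)]
  refine (W2_le_of_coupling _ _ _ (by fun_prop) (by fun_prop)).trans ?_
  refine ENNReal.rpow_le_rpow ?_ (by norm_num)
  calc _ ≤ ∫⁻ p, (L:ℝ≥0∞) ^ (2:ℝ) * ‖p.2‖ₑ ^ (2:ℝ) ∂(μ.prod (gM m σ)) := by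
        refine lintegral_mono fun p => ?_
        rw [← ENNReal.mul_rpow_of_nonneg _ _ (by norm_num)]
        refine ENNReal.rpow_le_rpow ?_ (by norm_num)
        have := hT (p.1 + p.2) p.1
        simpa [edist_eq_enorm_sub] using this
    _ = (L:ℝ≥0∞) ^ (2:ℝ) * ∫⁻ z, ‖z‖ₑ ^ (2:ℝ) ∂(gM m σ) := by
        rw [lintegral_const_mul _ (by fun_prop)]
        congr 1
        rw [lintegral_prod _ (by fun_prop)]
        simp
    _ ≤ _ := by gcongr; exact gM_moment m hσ

/-- For `μ ∈ 𝕎₂(ℝ^m)` and Lipschitz maps `T_θ, T_{θ'}` (with common Lipschitz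
constant `L`), `W₂((T_θ)♯μ, (T_{θ'})♯μ) = lim_{σ→0⁺} W₂((T_θ)♯(μ∗g_σ), (T_{θ'})♯(μ∗g_σ))`. -/
theorem wasserstein_mollified_limit {m : ℕ}
    (μ : Measure (EuclideanSpace ℝ (Fin m))) [IsProbabilityMeasure μ]
    (hmom : FiniteSecondMoment μ)
    (L : ℝ≥0) (Tθ Tθ' : EuclideanSpace ℝ (Fin m) → EuclideanSpace ℝ (Fin m))
    (hTθ : LipschitzWith L Tθ) (hTθ' : LipschitzWith L Tθ') :
    Filter.Tendsto (fun σ : ℝ => W2 ((mollify σ μ).map Tθ) ((mollify σ μ).map Tθ'))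
      (nhdsWithin 0 (Set.Ioi 0)) (nhds (W2 (μ.map Tθ) (μ.map Tθ'))) := by
  set e : ℝ → ℝ≥0∞ := fun σ =>
    ((L:ℝ≥0∞) ^ (2:ℝ) * ENNReal.ofReal (4 * σ ^ 2 * 2 ^ ((m:ℝ) / 2))) ^ (1 / 2 : ℝ) with he
  have hlim : Tendsto e (nhdsWithin 0 (Set.Ioi 0)) (nhds 0) := by
    have hc : Continuous e := by
      refine ENNReal.continuous_rpow_const.comp
        ((ENNReal.continuous_const_mul (by simp)).comp (ENNReal.continuous_ofReal.comp ?_))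
      fun_prop
    have := (hc.tendsto 0).mono_left (nhdsWithin_le_nhds (s := Set.Ioi 0))
    simpa [he] using this
  have hlim2 : Tendsto (fun σ => e σ + e σ) (nhdsWithin 0 (Set.Ioi 0)) (nhds 0) := by
    simpa using hlim.add hlim
  have hlo : Tendsto (fun σ => W2 (μ.map Tθ) (μ.map Tθ') - (e σ + e σ))
      (nhdsWithin 0 (Set.Ioi 0)) (nhds (W2 (μ.map Tθ) (μ.map Tθ'))) := by
    simpa using ENNReal.Tendsto.sub (tendsto_const_nhds (x := W2 (μ.map Tθ) (μ.map Tθ'))) hlim2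
      (Or.inr ENNReal.zero_ne_top)
  have hhi : Tendsto (fun σ => W2 (μ.map Tθ) (μ.map Tθ') + (e σ + e σ))
      (nhdsWithin 0 (Set.Ioi 0)) (nhds (W2 (μ.map Tθ) (μ.map Tθ'))) := by
    simpa using (tendsto_const_nhds (x := W2 (μ.map Tθ) (μ.map Tθ'))).add hlim2
  refine tendsto_of_tendsto_of_tendsto_of_le_of_le' hlo hhi ?_ ?_
  · filter_upwards [self_mem_nhdsWithin] with σ hσ
    have h1 := W2_mollify_le μ L Tθ hTθ hσ
    have h2 := W2_mollify_le μ L Tθ' hTθ' hσ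
    rw [tsub_le_iff_right]
    calc _ ≤ W2 (μ.map Tθ) ((mollify σ μ).map Tθ) + (W2 ((mollify σ μ).map Tθ) ((mollify σ μ).map Tθ')
            + W2 ((mollify σ μ).map Tθ') (μ.map Tθ')) :=
          (W2_triangle _ _ _).trans (add_le_add le_rfl (W2_triangle _ _ _))
      _ ≤ e σ + (W2 ((mollify σ μ).map Tθ) ((mollify σ μ).map Tθ') + e σ) :=
          add_le_add ((W2_comm_le _ _).trans h1) (add_le_add le_rfl h2)
      _ = _ := by ring
  · filter_upwards [self_mem_nhdsWithin] with σ hσ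
    have h1 := W2_mollify_le μ L Tθ hTθ hσ
    have h2 := W2_mollify_le μ L Tθ' hTθ' hσ
    calc _ ≤ W2 ((mollify σ μ).map Tθ) (μ.map Tθ) + (W2 (μ.map Tθ) (μ.map Tθ')
            + W2 (μ.map Tθ') ((mollify σ μ).map Tθ')) :=
          (W2_triangle _ _ _).trans (add_le_add le_rfl (W2_triangle _ _ _))
      _ ≤ e σ + (W2 (μ.map Tθ) (μ.map Tθ') + e σ) :=
          add_le_add h1 (add_le_add le_rfl ((W2_comm_le _ _).trans h2))
      _ = _ := by ring
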